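/- Let V be a Banach 𝕆-bimodule, T a bounded right para-linear operator on V, J ∈ 𝕊 and s ∈ ℂ_J with |s| > ‖T‖. Then: (1) for all x ∈ ℂ_J(V), (R_s − T)(∑_{n≥0} (T^{⊚n} ⊙ s^{−1−n})(x)) = x + α(s,T)(x), where α(s,T)(x) := ∑_{n≥0} [T, T^{⊚n}, x s^{−1−n}]_⊚; (2) for all x ∈ V, π_J(∑_{n≥0} (s^{−1−n} ⊙ T^{n⊚})((R_s − T)(x))) = π_J(x) + β(s,T)(x), where β(s,T)(x) := π_J(∑_{n≥0} [T^{n⊚}, T, x]_⊚ · s^{−1−n}). All the series converge in norm. -/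

import Mathlib

noncomputable section

open scoped BigOperators

/-- Octonions, realized via the Cayley–Dickson doubling of the quaternions. -/
@[ext]
structure Oct : Type where
  a : Quaternion ℝ
  b : Quaternion ℝ

namespace Oct

instance : Zero Oct := ⟨⟨0, 0⟩⟩
instance : Add Oct := ⟨fun x y => ⟨x.a + y.a, x.b + y.b⟩⟩
instance : Neg Oct := ⟨fun x => ⟨-x.a, -x.b⟩⟩
instance : Sub Oct := ⟨fun x y => ⟨x.a - y.a, x.b - y.b⟩⟩
instance : SMul ℕ Oct := ⟨fun n x => ⟨n • x.a, n • x.b⟩⟩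
instance : SMul ℤ Oct := ⟨fun n x => ⟨n • x.a, n • x.b⟩⟩
instance : SMul ℝ Oct := ⟨fun r x => ⟨r • x.a, r • x.b⟩⟩

def toLp (x : Oct) : WithLp 2 (Quaternion ℝ × Quaternion ℝ) :=
  (WithLp.equiv 2 (Quaternion ℝ × Quaternion ℝ)).symm (x.a, x.b)

lemma toLp_injective : Function.Injective toLp := by
  rintro ⟨xa, xb⟩ ⟨ya, yb⟩ h
  have ha : xa = ya :=
    congrArg (fun z => (WithLp.equiv 2 (Quaternion ℝ × Quaternion ℝ) z).1) h
  have hb : xb = yb :=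
    congrArg (fun z => (WithLp.equiv 2 (Quaternion ℝ × Quaternion ℝ) z).2) h
  subst ha; subst hb; rfl

instance : AddCommGroup Oct :=
  toLp_injective.addCommGroup toLp rfl (fun _ _ => rfl) (fun _ => rfl) (fun _ _ => rfl)
    (fun _ _ => rfl) (fun _ _ => rfl)

def toLpHom : Oct →+ WithLp 2 (Quaternion ℝ × Quaternion ℝ) where
  toFun := toLp
  map_zero' := rfl
  map_add' _ _ := rfl

instance : Module ℝ Oct := toLp_injective.module ℝ toLpHom fun _ _ => rfl

instance : NormedAddCommGroup Oct :=
  NormedAddCommGroup.induced Oct (WithLp 2 (Quaternion ℝ × Quaternion ℝ)) toLpHom toLp_injective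

instance : NormedSpace ℝ Oct := ⟨fun r x => norm_smul_le r (toLp x)⟩

def toProdLin : Oct →ₗ[ℝ] Quaternion ℝ × Quaternion ℝ where
  toFun x := (x.a, x.b)
  map_add' _ _ := rfl
  map_smul' _ _ := rfl

lemma toProdLin_injective : Function.Injective toProdLin := by
  rintro ⟨xa, xb⟩ ⟨ya, yb⟩ h
  have ha : xa = ya := congrArg Prod.fst h
  have hb : xb = yb := congrArg Prod.snd h
  subst ha; subst hb; rfl

instance : FiniteDimensional ℝ Oct :=
  FiniteDimensional.of_injective toProdLin toProdLin_injective

instance : CompleteSpace Oct := FiniteDimensional.complete ℝ Oct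

instance : One Oct := ⟨⟨1, 0⟩⟩

instance : Mul Oct :=
  ⟨fun x y => ⟨x.a * y.a - star y.b * x.b, y.b * x.a + x.b * star y.a⟩⟩

/-- Octonionic conjugation. -/
def conj (x : Oct) : Oct := ⟨star x.a, -x.b⟩

/-- The real part of an octonion. -/
def re (x : Oct) : ℝ := x.a.re

/-- Powers of an octonion (association chosen on the left factor). -/
def opow (s : Oct) : ℕ → Oct
  | 0 => 1
  | n + 1 => s * opow s n

/-- The inverse of a nonzero octonion. -/
def oinv (s : Oct) : Oct := (‖s‖ ^ 2)⁻¹ • conj s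

/-- `invPow s n` is the octonion `s ^ (-1 - n)`. -/
def invPow (s : Oct) (n : ℕ) : Oct := opow (oinv s) (n + 1)

def eNat : ℕ → Oct
  | 0 => ⟨1, 0⟩
  | 1 => ⟨⟨0, 1, 0, 0⟩, 0⟩
  | 2 => ⟨⟨0, 0, 1, 0⟩, 0⟩
  | 3 => ⟨⟨0, 0, 0, 1⟩, 0⟩
  | 4 => ⟨0, 1⟩
  | 5 => ⟨0, ⟨0, 1, 0, 0⟩⟩
  | 6 => ⟨0, ⟨0, 0, 1, 0⟩⟩
  | 7 => ⟨0, ⟨0, 0, 0, 1⟩⟩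
  | _ => 0

/-- The standard basis `e_0 = 1, e_1, …, e_7` of the octonions. -/
def e (i : Fin 8) : Oct := eNat i.val

/-- The six-dimensional sphere `𝕊` of imaginary units of `𝕆`. -/
def unitSphere : Set Oct := {J | J * J = -1}

/-- The slice `ℂ_J = ℝ ⊕ ℝJ` of the octonions. -/
def sliceC (J : Oct) : Set Oct := {s | ∃ x y : ℝ, s = x • (1 : Oct) + y • J}

/-- The embedding of `ℂ` onto the slice `ℂ_J`, `x + y i ↦ x + y J`. -/
def toSlice (J : Oct) (z : ℂ) : Oct := z.re • (1 : Oct) + z.im • J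

end Oct

open Oct

/-- A (normed/Banach) `𝕆`-bimodule: a real normed space with continuous real-bilinear left and
right octonionic multiplications satisfying the alternativity relations
`[p,q,x] = [q,x,p] = [x,p,q] = -[q,p,x]` and the norm identities `‖px‖ = |p|‖x‖ = ‖xp‖`. -/
class OctBimodule (V : Type*) [NormedAddCommGroup V] [NormedSpace ℝ V] : Type _ where
  lm : Oct →ₗ[ℝ] V →L[ℝ] V
  rm : Oct →ₗ[ℝ] V →L[ℝ] V
  lm_one : ∀ x : V, lm 1 x = x
  rm_one : ∀ x : V, rm 1 x = x
  /-- `[p,q,x] = [q,x,p]` -/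
  assoc_cyc₁ : ∀ (p q : Oct) (x : V),
    lm (p * q) x - lm p (lm q x) = rm p (lm q x) - lm q (rm p x)
  /-- `[p,q,x] = [x,p,q]` -/
  assoc_cyc₂ : ∀ (p q : Oct) (x : V),
    lm (p * q) x - lm p (lm q x) = rm q (rm p x) - rm (p * q) x
  /-- `[p,q,x] = -[q,p,x]` -/
  assoc_alt : ∀ (p q : Oct) (x : V),
    lm (p * q) x - lm p (lm q x) = -(lm (q * p) x - lm q (lm p x))
  norm_lm : ∀ (p : Oct) (x : V), ‖lm p x‖ = ‖p‖ * ‖x‖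
  norm_rm : ∀ (p : Oct) (x : V), ‖rm p x‖ = ‖p‖ * ‖x‖

section OctMod

variable {V : Type*} [NormedAddCommGroup V] [NormedSpace ℝ V] [OctBimodule V]

/-- Left multiplication `x ↦ p x` as a bounded real-linear operator. -/
def lmo (p : Oct) : V →L[ℝ] V := OctBimodule.lm p

/-- Right multiplication `R_p : x ↦ x p` as a bounded real-linear operator. -/
def rmo (p : Oct) : V →L[ℝ] V := OctBimodule.rm p

variable (V)

/-- The real-part projection `Re x = (5/12) x - (1/12) ∑_{i=1}^7 e_i x e_i` of an
`𝕆`-bimodule. -/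
def reO : V →L[ℝ] V :=
  (5 / 12 : ℝ) • ContinuousLinearMap.id ℝ V -
    (1 / 12 : ℝ) • ∑ i : Fin 7, (rmo (e i.succ)).comp (lmo (e i.succ))

/-- The real part `Re V` of an `𝕆`-bimodule, i.e. the set of associative central elements. -/
def ReSet : Set V :=
  {m | (∀ p q : Oct, lmo (p * q) m = lmo p (lmo q m)) ∧ ∀ p : Oct, lmo p m = rmo p m}

/-- The slice `ℂ_J(V) = Re V ⊕ J · Re V` of an `𝕆`-bimodule. -/
def CJV (J : Oct) : Set V :=
  {x | ∃ u ∈ ReSet V, ∃ w ∈ ReSet V, x = u + lmo J w}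

/-- The slice projection `π_J(x) = Re x + J Re (J̄ x)`. -/
def piJ (J : Oct) : V →L[ℝ] V :=
  reO V + (lmo J).comp ((reO V).comp (lmo (Oct.conj J)))

variable {V}

/-- The second right associator `B_p(T, x) = T(x) p - T(x p)` of an operator. -/
def Bop (p : Oct) (T : V →L[ℝ] V) : V →L[ℝ] V := (rmo p).comp T - T.comp (rmo p)

/-- A bounded real-linear operator is right (octonionic) para-linear if `Re B_p(T,x) = 0`. -/
def IsRightPara (T : V →L[ℝ] V) : Prop := ∀ (p : Oct) (x : V), reO V (Bop p T x) = 0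

/-- The left octonionic scalar multiplication `(p ⊙ T)(x) = p T(x) + B_p(T,x)` on operators. -/
def odotL (p : Oct) (T : V →L[ℝ] V) : V →L[ℝ] V := (lmo p).comp T + Bop p T

/-- The right octonionic scalar multiplication `(T ⊙ p)(x) = T(p x) - B_p(T,x)` on operators. -/
def odotR (T : V →L[ℝ] V) (p : Oct) : V →L[ℝ] V := T.comp (lmo p) - Bop p T

/-- The lifting map, `(lif F)(x) = ∑_i F(x ē_i) e_i`. -/
def lifO (F : V →L[ℝ] V) : V →L[ℝ] V :=
  ∑ i : Fin 8, (rmo (e i)).comp (F.comp (rmo (Oct.conj (e i))))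

/-- The extension map, `(ext G)(∑ x_i e_i) = ∑ G(x_i) e_i`, where `x_i = Re (x ē_i)`. -/
def extO (G : V →L[ℝ] V) : V →L[ℝ] V :=
  ∑ i : Fin 8, (rmo (e i)).comp (G.comp ((reO V).comp (rmo (Oct.conj (e i)))))

/-- The left regular power `T^{n⊚} = lif (Re ∘ Tⁿ)`. -/
def rpowL (T : V →L[ℝ] V) (n : ℕ) : V →L[ℝ] V := lifO ((reO V).comp (T ^ n))

/-- The right regular power `T^{⊚n} = ext (Tⁿ|_{Re V})`. -/
def rpowR (T : V →L[ℝ] V) (n : ℕ) : V →L[ℝ] V := extO (T ^ n)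

/-- The regular composition `f ⊚ g = lif (Re ∘ f ∘ g)`. -/
def rcomp (f g : V →L[ℝ] V) : V →L[ℝ] V := lifO ((reO V).comp (f.comp g))

/-- The composition associator `[f,g,x]_⊚ = (f ⊚ g)(x) - f(g(x))`. -/
def compAssoc (f g : V →L[ℝ] V) (x : V) : V := rcomp f g x - f (g x)

/-- The right regular inverse `T^{⊚-} = ext (T⁻¹|_{Re V})` of an invertible operator. -/
def rinvR (T : V →L[ℝ] V) : V →L[ℝ] V := extO (Ring.inverse T)

/-- The left regular inverse `T^{-⊚} = lif (Re ∘ T⁻¹)` of an invertible operator. -/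
def rinvL (T : V →L[ℝ] V) : V →L[ℝ] V := lifO ((reO V).comp (Ring.inverse T))

/-- An operator is power-associative if all of its (composition) powers are right
para-linear. -/
def IsPowerAssoc (T : V →L[ℝ] V) : Prop := ∀ n : ℕ, IsRightPara (T ^ n)

/-- A bounded operator is octonionic linear if `T(xp) = T(x)p` for all `p`. -/
def IsOctLinear (T : V →L[ℝ] V) : Prop := ∀ (p : Oct) (x : V), T (rmo p x) = rmo p (T x)

/-- `S` is `ℂ_J`-extendable power associative: `Sⁿ(v s) = Sⁿ(v) s` for `v ∈ Re V`,
`s ∈ ℂ_J`, `n ≥ 1`. -/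
def CJExtPA (J : Oct) (S : V →L[ℝ] V) : Prop :=
  ∀ n : ℕ, 1 ≤ n → ∀ v ∈ ReSet V, ∀ s ∈ sliceC J, (S ^ n) (rmo s v) = rmo s ((S ^ n) v)

/-- `S` is `ℂ_J`-liftable power associative: `Re (Sⁿ(v s)) = Re (Sⁿ(v) s)` for all `v ∈ V`,
`s ∈ ℂ_J`, `n ≥ 1`. -/
def CJLiftPA (J : Oct) (S : V →L[ℝ] V) : Prop :=
  ∀ n : ℕ, 1 ≤ n → ∀ (v : V), ∀ s ∈ sliceC J,
    reO V ((S ^ n) (rmo s v)) = reO V (rmo s ((S ^ n) v))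

/-- The pull-back slice-resolvent set `ρ*_J(T)`. -/
def pbResSlice (T : V →L[ℝ] V) (J : Oct) : Set Oct :=
  {s | s ∈ sliceC J ∧ IsUnit ((rmo s : V →L[ℝ] V) - T) ∧
    CJExtPA J (Ring.inverse ((rmo s : V →L[ℝ] V) - T))}

/-- The pull-back resolvent set `ρ*(T)`. -/
def pbRes (T : V →L[ℝ] V) : Set Oct := ⋃ J ∈ unitSphere, pbResSlice T J

/-- The pull-back spectrum `σ*(T) = 𝕆 ∖ ρ*(T)`. -/
def pbSpec (T : V →L[ℝ] V) : Set Oct := Set.univ \ pbRes T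

/-- The push-forward slice-resolvent set `ρ_{*J}(T)`. -/
def pfResSlice (T : V →L[ℝ] V) (J : Oct) : Set Oct :=
  {s | s ∈ sliceC J ∧ IsUnit ((rmo s : V →L[ℝ] V) - T) ∧
    CJLiftPA J (Ring.inverse ((rmo s : V →L[ℝ] V) - T))}

/-- The push-forward resolvent set `ρ_*(T)`. -/
def pfRes (T : V →L[ℝ] V) : Set Oct := ⋃ J ∈ unitSphere, pfResSlice T J

/-- The push-forward spectrum `σ_*(T) = 𝕆 ∖ ρ_*(T)`. -/
def pfSpec (T : V →L[ℝ] V) : Set Oct := Set.univ \ pfRes T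

/-- The real-part projection of the `𝕆`-bimodule `𝓑_RO(V)` of bounded right para-linear
operators, given by `Re A = (5/12) A - (1/12) ∑_{i=1}^7 (e_i ⊙ A) ⊙ e_i`. -/
def reOpB (A : V →L[ℝ] V) : V →L[ℝ] V :=
  (5 / 12 : ℝ) • A - (1 / 12 : ℝ) • ∑ i : Fin 7, odotR (odotL (e i.succ) A) (e i.succ)

end OctMod

/-- A set `U ⊆ 𝕆` is slice-open if `U ∩ ℂ_J` is open in `ℂ_J` for every `J ∈ 𝕊`. -/
def SliceOpen (U : Set Oct) : Prop :=
  ∀ J ∈ unitSphere, IsOpen (Oct.toSlice J ⁻¹' U)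

/-- A parametrization of the boundary `∂(U ∩ ℂ_J)` by finitely many continuously
differentiable, positively oriented Jordan curves (positivity of the orientation is encoded
through the winding numbers). -/
structure SliceContour (J : Oct) (U : Set Oct) where
  n : ℕ
  γ : Fin n → ℝ → ℂ
  smooth : ∀ i, ContDiff ℝ 1 (γ i)
  closed : ∀ i, γ i 0 = γ i 1
  jordan : ∀ i, Set.InjOn (γ i) (Set.Ico (0 : ℝ) 1)
  image_eq : (⋃ i, γ i '' Set.Icc (0 : ℝ) 1) = frontier (Oct.toSlice J ⁻¹' U)
  winding_inside : ∀ z : ℂ, Oct.toSlice J z ∈ U →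
    (∑ i, ∫ t in (0 : ℝ)..1, deriv (γ i) t / (γ i t - z)) = 2 * (Real.pi : ℂ) * Complex.I
  winding_outside : ∀ z : ℂ, Oct.toSlice J z ∉ closure U →
    (∑ i, ∫ t in (0 : ℝ)..1, deriv (γ i) t / (γ i t - z)) = 0

/-- The integral `∫_{∂(U ∩ ℂ_J)} Φ(s, ds)` along a slice contour: the integrand gets the
point of the curve and its derivative (both in the coordinates of the slice). -/
def contourSum {J : Oct} {U : Set Oct} (Γ : SliceContour J U) {E : Type*}
    [NormedAddCommGroup E] [NormedSpace ℝ E] (Φ : ℂ → ℂ → E) : E :=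
  ∑ i, ∫ t in (0 : ℝ)..1, Φ (Γ.γ i t) (deriv (Γ.γ i) t)

/-- An axially symmetric slice domain (s-domain) in `𝕆`. -/
structure IsAdmissibleDomain (U : Set Oct) : Prop where
  isOpen : IsOpen U
  isConnected : IsConnected U
  real_nonempty : (U ∩ {s : Oct | ∃ r : ℝ, s = r • (1 : Oct)}).Nonempty
  axially : ∀ (z : ℂ), ∀ I ∈ unitSphere, ∀ J ∈ unitSphere,
    Oct.toSlice I z ∈ U → Oct.toSlice J z ∈ U
  slice_conn : ∀ J ∈ unitSphere, IsConnected (Oct.toSlice J ⁻¹' U)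

section Adm

variable {V : Type*} [NormedAddCommGroup V] [NormedSpace ℝ V] [OctBimodule V]

/-- A `T`-left-admissible domain: an axially symmetric s-domain containing the pull-back
spectrum `σ*(T)`.  (The regularity of its slice boundaries is witnessed by the slice
contours used in the integrals.) -/
def LeftAdmissible (T : V →L[ℝ] V) (U : Set Oct) : Prop :=
  IsAdmissibleDomain U ∧ pbSpec T ⊆ U

/-- A `T`-right-admissible domain: an axially symmetric s-domain containing the push-forward
spectrum `σ_*(T)`. -/
def RightAdmissible (T : V →L[ℝ] V) (U : Set Oct) : Prop :=
  IsAdmissibleDomain U ∧ pfSpec T ⊆ U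

end Adm

/-- The axially symmetric set `Ω_D ⊆ 𝕆` induced by a conjugation-invariant set `D ⊆ ℂ`. -/
def OmegaD (D : Set ℂ) : Set Oct := ⋃ J ∈ unitSphere, Oct.toSlice J '' D

/-- `F` is the stem of a slice preserving slice regular function on `Ω_D`: it is holomorphic
on the open conjugation-invariant set `D` and intertwines complex conjugation. -/
structure IsStem (D : Set ℂ) (F : ℂ → ℂ) : Prop where
  isOpen : IsOpen D
  conj_mem : ∀ z ∈ D, (starRingEnd ℂ) z ∈ D
  holo : DifferentiableOn ℂ F D
  conj_comm : ∀ z ∈ D, F ((starRingEnd ℂ) z) = (starRingEnd ℂ) (F z)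

section FC

variable {V : Type*} [NormedAddCommGroup V] [NormedSpace ℝ V] [OctBimodule V]

/-- The slice integral `(1/2π) ∫_{∂(U∩ℂ_J)} (R_s - T)^{⊚-} ⊙ (ds_J f(s))` defining the left
slice regular functional calculus of a slice preserving function with stem `F`. -/
def leftFC (T : V →L[ℝ] V) (J : Oct) {U : Set Oct} (Γ : SliceContour J U)
    (F : ℂ → ℂ) : V →L[ℝ] V :=
  (2 * Real.pi)⁻¹ • contourSum Γ fun z dz =>
    odotR (rinvR ((rmo (Oct.toSlice J z) : V →L[ℝ] V) - T))
      ((-(Oct.toSlice J dz) * J) * Oct.toSlice J (F z))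

/-- The slice integral `(1/2π) ∫_{∂(U∩ℂ_J)} (f(s) ds_J) ⊙ (R_s - T)^{-⊚}` defining the right
slice regular functional calculus of a slice preserving function with stem `F`. -/
def rightFC (T : V →L[ℝ] V) (J : Oct) {U : Set Oct} (Γ : SliceContour J U)
    (F : ℂ → ℂ) : V →L[ℝ] V :=
  (2 * Real.pi)⁻¹ • contourSum Γ fun z dz =>
    odotL (Oct.toSlice J (F z) * (-(Oct.toSlice J dz) * J))
      (rinvL ((rmo (Oct.toSlice J z) : V →L[ℝ] V) - T))

end FC

/-- The family of stems of the components, relative to `J = ∑ c_i e_i`, of a function of the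
form `f₀ + f₁ • J` with `f₀, f₁` slice preserving with stems `F₀, F₁`. -/
def stemFamily (c : Fin 8 → ℝ) (F₀ F₁ : ℂ → ℂ) : Fin 8 → ℂ → ℂ :=
  fun i z => if i = 0 then F₀ z else (c i : ℂ) * F₁ z

namespace Oct

/-- Left multiplication by an octonion, as a real-linear map. -/
def lmulLin (q : Oct) : Oct →ₗ[ℝ] Oct where
  toFun x := q * x
  map_add' x y := by
    refine Oct.ext ?_ ?_
    · show q.a * (x.a + y.a) - star (x.b + y.b) * q.b =
        (q.a * x.a - star x.b * q.b) + (q.a * y.a - star y.b * q.b)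
      rw [mul_add, star_add, add_mul]; abel
    · show (x.b + y.b) * q.a + q.b * star (x.a + y.a) =
        (x.b * q.a + q.b * star x.a) + (y.b * q.a + q.b * star y.a)
      rw [add_mul, star_add, mul_add]; abel
  map_smul' r x := by
    refine Oct.ext ?_ ?_
    · show q.a * (r • x.a) - star (r • x.b) * q.b = r • (q.a * x.a - star x.b * q.b)
      rw [mul_smul_comm, Quaternion.star_smul, smul_mul_assoc, smul_sub]
    · show (r • x.b) * q.a + q.b * star (r • x.a) = r • (x.b * q.a + q.b * star x.a)
      rw [smul_mul_assoc, Quaternion.star_smul, mul_smul_comm, smul_add]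

/-- Left multiplication `L_q : x ↦ q x` as a bounded real-linear operator on `𝕆`. -/
def Lq (q : Oct) : Oct →L[ℝ] Oct := (lmulLin q).toContinuousLinearMap

/-- The two-sphere `[q] = {Re q + |Im q| J : J ∈ 𝕊}` associated with an octonion `q`. -/
def qSphere (q : Oct) : Set Oct :=
  {s | ∃ J ∈ unitSphere, s = Oct.re q • (1 : Oct) + ‖q - Oct.re q • (1 : Oct)‖ • J}

end Oct

section AlternativeRing

variable {A : Type*} [NonUnitalNonAssocRing A]

/-- The Kleinfeld function of a nonassociative ring. -/
def kleinfeld (w x y z : A) : A :=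
  associator (w * x) y z - x * associator w y z - associator x y z * w

/-- In an alternative ring, `[[a,b],c,x] + [[b,c],a,x] + [[c,a],b,x] = 2 [[a,b,c],x]`. -/
lemma sum_associator_commutator
    (h₁ : ∀ x y z : A, associator x y z = -associator y x z)
    (h₂ : ∀ x y z : A, associator x y z = -associator x z y) (a b c x : A) :
    associator (a * b - b * a) c x + associator (b * c - c * b) a x
      + associator (c * a - a * c) b x
      = (2 : ℤ) • (associator a b c * x - x * associator a b c) := by
  have hc : ∀ x y z : A, associator x y z = associator y z x := fun x y z => by
    rw [h₁ x y z, h₂ y x z, neg_neg]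
  have hsub : ∀ p q y z : A, associator (p - q) y z = associator p y z - associator q y z := by
    intro p q y z
    simp only [associator_apply, sub_mul]
    abel
  have teich : ∀ w x y z : A, associator (w * x) y z - associator (x * y) z w
      + associator (y * z) w x = w * associator x y z + associator w x y * z := by
    intro w x y z
    rw [← hc w (x * y) z, hc (y * z) w x]
    simp only [associator_apply, sub_mul, mul_sub]
    abel
  have G : ∀ w x y z : A, kleinfeld w x y z - kleinfeld x y z w + kleinfeld y z w x =
      (w * associator x y z - associator x y z * w)
      - (x * associator y z w - associator y z w * x)
      + (y * associator z w x - associator z w x * y)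
      - (z * associator w x y - associator w x y * z) := by
    intro w x y z
    have t := teich w x y z
    simp only [kleinfeld]
    rw [hc w y z, hc x z w, hc y w x]
    rw [← sub_eq_zero] at t ⊢
    rw [← t]
    abel
  have cyc : ∀ w x y z : A, kleinfeld w x y z = -kleinfeld z w x y := by
    intro w x y z
    have g₁ := G w x y z
    have g₂ := G x y z w
    have : kleinfeld w x y z + kleinfeld z w x y = 0 := by
      rw [show kleinfeld w x y z + kleinfeld z w x y
        = (kleinfeld w x y z - kleinfeld x y z w + kleinfeld y z w x)
          + (kleinfeld x y z w - kleinfeld y z w x + kleinfeld z w x y) by abel, g₁, g₂]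
      abel
    exact eq_neg_of_add_eq_zero_left this
  have sw : ∀ w x y z : A, kleinfeld w x y z = -kleinfeld w x z y := by
    intro w x y z
    simp only [kleinfeld]
    rw [h₂ (w * x) y z, h₂ w y z, h₂ x y z]
    simp only [mul_neg, neg_mul]
    abel
  have sw₁ : ∀ w x y z : A, kleinfeld w x y z = -kleinfeld x w y z := by
    intro w x y z
    rw [cyc w x y z, cyc z w x y, sw y z w x, cyc y z x w, cyc w y z x, cyc x w y z]
    simp
  have sw₂ : ∀ w x y z : A, kleinfeld w x y z = -kleinfeld w y x z := by
    intro w x y z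
    rw [cyc w x y z, sw z w x y, cyc w y x z]
  have g := G a b c x
  rw [cyc b c x a, cyc c x a b, cyc b c x a, neg_neg, sub_neg_eq_add] at g
  have t : ∀ a b c : A, associator (a * b - b * a) c x = (2 : ℤ) • kleinfeld a b c x
      + (b * associator a c x - associator a c x * b)
      - (a * associator b c x - associator b c x * a) := by
    intro a b c
    rw [two_smul]
    nth_rewrite 2 [sw₁]
    simp only [kleinfeld, hsub]
    abel
  have r₁ : kleinfeld b c a x = kleinfeld a b c x := by rw [sw₂, sw₁, neg_neg]
  have r₂ : kleinfeld c a b x = kleinfeld a b c x := by rw [sw₁, sw₂, neg_neg]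
  rw [t a b c, t b c a, t c a b, r₁, r₂, h₁ c b x, h₁ b a x, h₁ a c x]
  rw [hc x a b, h₂ c x a] at g
  have k := congrArg ((2 : ℤ) • ·) g
  simp only [two_smul, mul_neg, neg_mul] at k ⊢
  rw [← sub_eq_zero] at k ⊢
  rw [← k]
  abel

end AlternativeRing

namespace Oct

@[simp] lemma zero_a : (0 : Oct).a = 0 := rfl
@[simp] lemma zero_b : (0 : Oct).b = 0 := rfl
@[simp] lemma one_a : (1 : Oct).a = 1 := rfl
@[simp] lemma one_b : (1 : Oct).b = 0 := rfl
@[simp] lemma add_a (x y : Oct) : (x + y).a = x.a + y.a := rfl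
@[simp] lemma add_b (x y : Oct) : (x + y).b = x.b + y.b := rfl
@[simp] lemma sub_a (x y : Oct) : (x - y).a = x.a - y.a := rfl
@[simp] lemma sub_b (x y : Oct) : (x - y).b = x.b - y.b := rfl
@[simp] lemma neg_a (x : Oct) : (-x).a = -x.a := rfl
@[simp] lemma neg_b (x : Oct) : (-x).b = -x.b := rfl
@[simp] lemma smul_a (r : ℝ) (x : Oct) : (r • x).a = r • x.a := rfl
@[simp] lemma smul_b (r : ℝ) (x : Oct) : (r • x).b = r • x.b := rfl
@[simp] lemma mul_a (x y : Oct) : (x * y).a = x.a * y.a - star y.b * x.b := rfl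
@[simp] lemma mul_b (x y : Oct) : (x * y).b = y.b * x.a + x.b * star y.a := rfl
@[simp] lemma conj_a (x : Oct) : (conj x).a = star x.a := rfl
@[simp] lemma conj_b (x : Oct) : (conj x).b = -x.b := rfl

lemma norm_sq (x : Oct) : ‖x‖ ^ 2 = Quaternion.normSq x.a + Quaternion.normSq x.b := by
  have h : ‖x‖ = ‖toLp x‖ := rfl
  rw [h, WithLp.prod_norm_sq_eq_of_L2, Quaternion.normSq_eq_norm_mul_self,
    Quaternion.normSq_eq_norm_mul_self, ← sq, ← sq]
  rfl

set_option maxHeartbeats 4000000 in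
lemma mul_assoc_alt₁ (x y z : Oct) : x * y * z - x * (y * z) = -(y * x * z - y * (x * z)) := by
  ext <;> simp only [mul_a, mul_b, sub_a, sub_b, neg_a, neg_b, Quaternion.re_sub, Quaternion.imI_sub,
    Quaternion.imJ_sub, Quaternion.imK_sub, Quaternion.re_add, Quaternion.imI_add,
    Quaternion.imJ_add, Quaternion.imK_add, Quaternion.re_neg, Quaternion.imI_neg,
    Quaternion.imJ_neg, Quaternion.imK_neg, Quaternion.re_mul, Quaternion.imI_mul,
    Quaternion.imJ_mul, Quaternion.imK_mul, Quaternion.re_star, Quaternion.imI_star,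
    Quaternion.imJ_star, Quaternion.imK_star] <;> ring

set_option maxHeartbeats 4000000 in
lemma mul_assoc_alt₂ (x y z : Oct) : x * y * z - x * (y * z) = -(x * z * y - x * (z * y)) := by
  ext <;> simp only [mul_a, mul_b, sub_a, sub_b, neg_a, neg_b, Quaternion.re_sub, Quaternion.imI_sub,
    Quaternion.imJ_sub, Quaternion.imK_sub, Quaternion.re_add, Quaternion.imI_add,
    Quaternion.imJ_add, Quaternion.imK_add, Quaternion.re_neg, Quaternion.imI_neg,
    Quaternion.imJ_neg, Quaternion.imK_neg, Quaternion.re_mul, Quaternion.imI_mul,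
    Quaternion.imJ_mul, Quaternion.imK_mul, Quaternion.re_star, Quaternion.imI_star,
    Quaternion.imJ_star, Quaternion.imK_star] <;> ring

end Oct

/-- The split null extension `𝕆 ⊕ V` of an `𝕆`-bimodule. -/
def NullExt (V : Type*) : Type _ := Oct × V

namespace NullExt

variable {V : Type*} [NormedAddCommGroup V] [NormedSpace ℝ V] [OctBimodule V]

instance : AddCommGroup (NullExt V) := inferInstanceAs (AddCommGroup (Oct × V))

instance : Mul (NullExt V) := ⟨fun x y => (x.1 * y.1, lmo x.1 y.2 + rmo y.1 x.2)⟩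

end NullExt

namespace Oct

lemma mul_add' (x y z : Oct) : x * (y + z) = x * y + x * z := (lmulLin x).map_add y z

lemma add_mul' (x y z : Oct) : (x + y) * z = x * z + y * z := by
  ext1
  · simp only [mul_a, add_a, add_b, add_mul, mul_add]; abel
  · simp only [mul_b, add_a, add_b, add_mul, mul_add]; abel

lemma mul_smul' (x : Oct) (r : ℝ) (y : Oct) : x * (r • y) = r • (x * y) := (lmulLin x).map_smul r y

lemma smul_mul' (x : Oct) (r : ℝ) (y : Oct) : (r • x) * y = r • (x * y) := by
  ext1
  · simp [mul_a, smul_sub]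
  · simp [mul_b]

protected lemma one_mul' (x : Oct) : 1 * x = x := by ext1 <;> simp

protected lemma mul_one' (x : Oct) : x * 1 = x := by ext1 <;> simp

instance : NonUnitalNonAssocRing Oct where
  left_distrib := mul_add'
  right_distrib := add_mul'
  zero_mul x := by ext1 <;> simp
  mul_zero x := by ext1 <;> simp

instance : IsScalarTower ℝ Oct Oct := ⟨fun r x y => smul_mul' x r y⟩

instance : SMulCommClass ℝ Oct Oct := ⟨fun r x y => (mul_smul' x r y).symm⟩

end Oct

section Bimodule

variable {V : Type*} [NormedAddCommGroup V] [NormedSpace ℝ V] [OctBimodule V]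

lemma lmo_add (p q : Oct) : lmo (V := V) (p + q) = lmo p + lmo q := map_add OctBimodule.lm p q
lemma rmo_add (p q : Oct) : rmo (V := V) (p + q) = rmo p + rmo q := map_add OctBimodule.rm p q
lemma lmo_smul (r : ℝ) (p : Oct) : lmo (V := V) (r • p) = r • lmo p := map_smul OctBimodule.lm r p
lemma rmo_smul (r : ℝ) (p : Oct) : rmo (V := V) (r • p) = r • rmo p := map_smul OctBimodule.rm r p
lemma lmo_neg (p : Oct) : lmo (V := V) (-p) = -lmo p := map_neg OctBimodule.lm p
lemma rmo_neg (p : Oct) : rmo (V := V) (-p) = -rmo p := map_neg OctBimodule.rm p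
lemma lmo_sub (p q : Oct) : lmo (V := V) (p - q) = lmo p - lmo q := map_sub OctBimodule.lm p q
lemma rmo_sub (p q : Oct) : rmo (V := V) (p - q) = rmo p - rmo q := map_sub OctBimodule.rm p q
lemma lmo_one (x : V) : lmo 1 x = x := OctBimodule.lm_one x
lemma rmo_one (x : V) : rmo 1 x = x := OctBimodule.rm_one x

variable (V) in
/-- The left associator `x ↦ [p, q, x]`, bilinear in `p` and `q`. -/
def lassoc : Oct →ₗ[ℝ] Oct →ₗ[ℝ] V →L[ℝ] V :=
  LinearMap.mk₂ ℝ (fun p q => lmo (p * q) - (lmo p).comp (lmo q))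
    (fun p p' q => by ext; simp [add_mul, lmo_add]; abel)
    (fun r p q => by ext; simp only [Oct.smul_mul', lmo_smul]; simp [smul_sub])
    (fun p q q' => by ext; simp [mul_add, lmo_add]; abel)
    (fun r p q => by ext; simp only [Oct.mul_smul', lmo_smul]; simp [smul_sub])

lemma lassoc_eq₀ (p q : Oct) (x : V) : lassoc V p q x = lmo (p * q) x - lmo p (lmo q x) := rfl

lemma lassoc_eq₁ (p q : Oct) (x : V) : lassoc V p q x = rmo p (lmo q x) - lmo q (rmo p x) :=
  OctBimodule.assoc_cyc₁ p q x

lemma lassoc_eq₂ (p q : Oct) (x : V) : lassoc V p q x = rmo q (rmo p x) - rmo (p * q) x :=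
  OctBimodule.assoc_cyc₂ p q x

lemma lassoc_swap (p q : Oct) (x : V) : lassoc V p q x = -lassoc V q p x :=
  OctBimodule.assoc_alt p q x

lemma lassoc_self (p : Oct) (x : V) : lassoc V p p x = 0 :=  by
  have h := eq_neg_iff_add_eq_zero.mp (lassoc_swap p p x)
  rw [← two_smul ℝ] at h
  exact (smul_eq_zero.mp h).resolve_left two_ne_zero

lemma lassoc_one_left (p : Oct) (x : V) : lassoc V 1 p x = 0 := by
  rw [lassoc_eq₀, Oct.one_mul', lmo_one, sub_self]

lemma lassoc_one_right (p : Oct) (x : V) : lassoc V p 1 x = 0 := by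
  rw [lassoc_swap, lassoc_one_left, neg_zero]

instance : NonUnitalNonAssocRing (NullExt V) where
  left_distrib x y z := Prod.ext (mul_add x.1 y.1 z.1) <| by
    change lmo x.1 (y.2 + z.2) + rmo (y.1 + z.1) x.2
      = (lmo x.1 y.2 + rmo y.1 x.2) + (lmo x.1 z.2 + rmo z.1 x.2)
    simp only [map_add, rmo_add, add_apply]
    abel
  right_distrib x y z := Prod.ext (add_mul x.1 y.1 z.1) <| by
    change lmo (x.1 + y.1) z.2 + rmo z.1 (x.2 + y.2)
      = (lmo x.1 z.2 + rmo z.1 x.2) + (lmo y.1 z.2 + rmo z.1 y.2)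
    simp only [map_add, lmo_add, add_apply]
    abel
  zero_mul x := Prod.ext (zero_mul x.1) <| by
    change lmo 0 x.2 + rmo x.1 (0 : V) = 0
    simp [lmo]
  mul_zero x := Prod.ext (mul_zero x.1) <| by
    change lmo x.1 (0 : V) + rmo 0 x.2 = 0
    simp [rmo]

namespace NullExt

/-- The inclusion of `𝕆`. -/
def inl (p : Oct) : NullExt V := (p, 0)

/-- The inclusion of `V`. -/
def inr (x : V) : NullExt V := (0, x)

lemma inl_fst (p : Oct) : (inl p : NullExt V).1 = p := rfl
lemma inl_snd (p : Oct) : (inl p : NullExt V).2 = 0 := rfl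
lemma inr_fst (x : V) : (inr x).1 = 0 := rfl
lemma inr_snd (x : V) : (inr x).2 = x := rfl
lemma add_snd (x y : NullExt V) : (x + y).2 = x.2 + y.2 := rfl
omit [NormedSpace ℝ V] [OctBimodule V] in
lemma sub_fst (x y : NullExt V) : (x - y).1 = x.1 - y.1 := rfl
omit [NormedSpace ℝ V] [OctBimodule V] in
lemma sub_snd (x y : NullExt V) : (x - y).2 = x.2 - y.2 := rfl
lemma mul_fst (x y : NullExt V) : (x * y).1 = x.1 * y.1 := rfl
lemma mul_snd (x y : NullExt V) : (x * y).2 = lmo x.1 y.2 + rmo y.1 x.2 := rfl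

end NullExt

lemma NullExt.associator_fst (x y z : NullExt V) :
    (associator x y z).1 = associator x.1 y.1 z.1 := rfl

lemma NullExt.associator_snd (x y z : NullExt V) :
    (associator x y z).2 = lassoc V y.1 z.1 x.2 + lassoc V z.1 x.1 y.2 + lassoc V x.1 y.1 z.2 := by
  rw [lassoc_eq₂, lassoc_eq₁, lassoc_eq₀]
  change lmo (x.1 * y.1) z.2 + rmo z.1 (lmo x.1 y.2 + rmo y.1 x.2)
    - (lmo x.1 (lmo y.1 z.2 + rmo z.1 y.2) + rmo (y.1 * z.1) x.2) = _
  simp only [map_add]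
  abel

/-- The octonionic bimodule form of `sum_associator_commutator`. -/
lemma sum_lassoc_commutator (a b c : Oct) (x : V) :
    lassoc V (a * b - b * a) c x + lassoc V (b * c - c * b) a x + lassoc V (c * a - a * c) b x
      = (2 : ℝ) • (lmo (associator a b c) x - rmo (associator a b c) x) := by
  have h := sum_associator_commutator (A := NullExt V)
    (fun x y z => Prod.ext (Oct.mul_assoc_alt₁ x.1 y.1 z.1) <| by
      change _ = -(associator y x z).2
      rw [NullExt.associator_snd, NullExt.associator_snd, lassoc_swap y.1 z.1,
        lassoc_swap z.1 x.1, lassoc_swap x.1 y.1]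
      abel)
    (fun x y z => Prod.ext (Oct.mul_assoc_alt₂ x.1 y.1 z.1) <| by
      change _ = -(associator x z y).2
      rw [NullExt.associator_snd, NullExt.associator_snd, lassoc_swap y.1 z.1,
        lassoc_swap z.1 x.1, lassoc_swap x.1 y.1]
      abel)
    (NullExt.inl a) (NullExt.inl b) (NullExt.inl c) (NullExt.inr x)
  have h' := congrArg Prod.snd h
  simp only [two_smul] at h' ⊢
  simp only [NullExt.associator_snd, NullExt.add_snd, NullExt.sub_snd, NullExt.mul_snd,
    NullExt.associator_fst, NullExt.sub_fst, NullExt.mul_fst, NullExt.inl_fst, NullExt.inl_snd,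
    NullExt.inr_fst, NullExt.inr_snd] at h'
  simpa using h'

end Bimodule

namespace Oct

lemma e_a_re (i : Fin 8) : (e i).a.re = if i = 0 then 1 else 0 := by fin_cases i <;> rfl
lemma e_a_imI (i : Fin 8) : (e i).a.imI = if i = 1 then 1 else 0 := by fin_cases i <;> rfl
lemma e_a_imJ (i : Fin 8) : (e i).a.imJ = if i = 2 then 1 else 0 := by fin_cases i <;> rfl
lemma e_a_imK (i : Fin 8) : (e i).a.imK = if i = 3 then 1 else 0 := by fin_cases i <;> rfl
lemma e_b_re (i : Fin 8) : (e i).b.re = if i = 4 then 1 else 0 := by fin_cases i <;> rfl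
lemma e_b_imI (i : Fin 8) : (e i).b.imI = if i = 5 then 1 else 0 := by fin_cases i <;> rfl
lemma e_b_imJ (i : Fin 8) : (e i).b.imJ = if i = 6 then 1 else 0 := by fin_cases i <;> rfl
lemma e_b_imK (i : Fin 8) : (e i).b.imK = if i = 7 then 1 else 0 := by fin_cases i <;> rfl

/-- The signs in the multiplication table of the octonions. -/
def mulSign : Matrix (Fin 8) (Fin 8) ℝ :=
  !![1, 1, 1, 1, 1, 1, 1, 1;
    1, -1, 1, -1, 1, -1, -1, 1;
    1, -1, -1, 1, 1, 1, -1, -1;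
    1, 1, -1, -1, 1, -1, 1, -1;
    1, -1, -1, -1, -1, 1, 1, 1;
    1, 1, -1, 1, -1, -1, -1, 1;
    1, 1, 1, -1, -1, 1, -1, -1;
    1, -1, 1, 1, -1, -1, 1, -1]

set_option maxHeartbeats 4000000 in
lemma e_mul_e (i j : Fin 8) : e i * e j = mulSign i j • e (i ^^^ j) := by
  fin_cases i <;> fin_cases j <;>
    ext <;>
    simp only [mul_a, mul_b, smul_a, smul_b, Quaternion.re_sub, Quaternion.imI_sub,
      Quaternion.imJ_sub, Quaternion.imK_sub, Quaternion.re_add, Quaternion.imI_add,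
      Quaternion.imJ_add, Quaternion.imK_add, Quaternion.re_mul, Quaternion.imI_mul,
      Quaternion.imJ_mul, Quaternion.imK_mul, Quaternion.re_star, Quaternion.imI_star,
      Quaternion.imJ_star, Quaternion.imK_star, Quaternion.re_smul, Quaternion.imI_smul,
      Quaternion.imJ_smul, Quaternion.imK_smul] <;>
    simp [e_a_re, e_a_imI, e_a_imJ, e_a_imK, e_b_re, e_b_imI, e_b_imJ, e_b_imK, mulSign]

lemma e_zero : e 0 = 1 := rfl

end Oct

section Casimir

/-- A Casimir identity relating right and left multiplication by `e_j`, `j ≠ 0`. -/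
lemma sum_e_mul_comm {W : Type*} [AddCommGroup W] [Module ℝ W] (B : Oct →ₗ[ℝ] Oct →ₗ[ℝ] W)
    (j : Fin 7) :
    ∑ i : Fin 8, B (e i) (e i * e j.succ) = ∑ i : Fin 8, B (e j.succ * e i) (e i)
      + (2 : ℝ) • B 1 (e j.succ) - (2 : ℝ) • B (e j.succ) 1 := by
  rw [two_smul, two_smul, ← e_zero]
  fin_cases j <;>
    · simp only [Fin.sum_univ_eight, e_mul_e, map_smul, LinearMap.smul_apply]
      simp [mulSign]
      abel

variable {V : Type*} [NormedAddCommGroup V] [NormedSpace ℝ V] [OctBimodule V]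

/-- The triples of basis elements whose product is, up to sign, a given imaginary unit. -/
def mulTriple : Fin 7 → Fin 8 × Fin 8 × Fin 8 :=
  ![(2, 4, 7), (1, 4, 7), (1, 4, 6), (1, 2, 7), (1, 2, 6), (1, 2, 5), (1, 2, 4)]

lemma sum_lassoc_e_mul (j : Fin 7) (x : V) :
    ∑ i : Fin 7, lassoc V (e i.succ) (e j.succ * e i.succ) x
      = (4 : ℝ) • (lmo (e j.succ) x - rmo (e j.succ) x) := by
  have h := sum_lassoc_commutator (e (mulTriple j).1) (e (mulTriple j).2.1) (e (mulTriple j).2.2) x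
  have sw := fun p q : Fin 8 => lassoc_swap (e p) (e q) x
  simp only [associator_apply, e_mul_e, Fin.sum_univ_seven, lmo_smul, rmo_smul, lmo_sub, rmo_sub,
    map_smul, map_sub, smul_mul_assoc, mul_smul_comm, LinearMap.smul_apply, LinearMap.sub_apply] at h ⊢
  fin_cases j <;>
  · simp [mulSign, mulTriple, e_zero, lassoc_one_right] at h ⊢
    simp only [sw 2 1, sw 3 1, sw 3 2, sw 4 1, sw 4 2, sw 4 3,
      sw 5 1, sw 5 2, sw 5 3, sw 5 4, sw 6 1, sw 6 2,
      sw 6 3, sw 6 4, sw 6 5, sw 7 1,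
      sw 7 2, sw 7 3, sw 7 4, sw 7 5, sw 7 6] at h ⊢
    first
    | linear_combination (norm := module) h
    | linear_combination (norm := module) (-1 : ℝ) • h

end Casimir

namespace Oct

lemma e_succ_sq (i : Fin 7) : e i.succ * e i.succ = -1 := by
  rw [e_mul_e, ← neg_one_smul ℝ, ← e_zero]
  fin_cases i <;> simp [mulSign]

lemma e_mul_anticomm {i j : Fin 7} (h : i ≠ j) : e i.succ * e j.succ = -(e j.succ * e i.succ) := by
  rw [e_mul_e, e_mul_e, ← neg_smul]
  fin_cases i <;> fin_cases j <;> simp [mulSign] at h ⊢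

lemma mul_mul_self_of_sq {a : Oct} (ha : a * a = -1) (p : Oct) : p * a * a = -p := by
  have h := mul_assoc_alt₂ p a a
  have h' : p * a * a - p * (a * a) = 0 := by
    have h2 := eq_neg_iff_add_eq_zero.mp h
    rw [← two_smul ℝ] at h2
    exact (smul_eq_zero.mp h2).resolve_left two_ne_zero
  rw [sub_eq_zero.mp h', ha, mul_neg, Oct.mul_one']

lemma self_mul_mul_of_sq {a : Oct} (ha : a * a = -1) (p : Oct) : a * (a * p) = -p := by
  have h := mul_assoc_alt₁ a a p
  have h' : a * a * p - a * (a * p) = 0 := by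
    have h2 := eq_neg_iff_add_eq_zero.mp h
    rw [← two_smul ℝ] at h2
    exact (smul_eq_zero.mp h2).resolve_left two_ne_zero
  rw [← sub_eq_zero.mp h', ha, neg_mul, Oct.one_mul']

end Oct

section Moufang

variable {V : Type*} [NormedAddCommGroup V] [NormedSpace ℝ V] [OctBimodule V]

lemma lmo_lmo (p q : Oct) (x : V) : lmo p (lmo q x) = lmo (p * q) x - lassoc V p q x := by
  rw [lassoc_eq₀]; abel

lemma rmo_rmo (p q : Oct) (x : V) : rmo q (rmo p x) = rmo (p * q) x + lassoc V p q x := by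
  rw [lassoc_eq₂]; abel

lemma rmo_lmo (p q : Oct) (x : V) : rmo p (lmo q x) = lmo q (rmo p x) + lassoc V p q x := by
  rw [lassoc_eq₁]; abel

lemma lmo_neg_one (x : V) : lmo (-1) x = -x := by rw [lmo_neg, neg_apply, lmo_one]

lemma rmo_neg_one (x : V) : rmo (-1) x = -x := by rw [rmo_neg, neg_apply, rmo_one]

variable {a : Oct} (ha : a * a = -1)
include ha

lemma lmo_lmo_self (x : V) : lmo a (lmo a x) = -x := by
  rw [lmo_lmo, lassoc_self, ha, lmo_neg_one, sub_zero]

lemma rmo_rmo_self (x : V) : rmo a (rmo a x) = -x := by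
  rw [rmo_rmo, lassoc_self, ha, rmo_neg_one, add_zero]

lemma lassoc_lmo_self (p : Oct) (x : V) : lassoc V p a (lmo a x) = -lassoc V (p * a) a x := by
  rw [lassoc_eq₀, lmo_lmo_self ha, lmo_lmo, mul_mul_self_of_sq ha, map_neg, lmo_neg, neg_apply]
  abel

lemma rmo_self_lassoc (p : Oct) (x : V) : rmo a (lassoc V p a x) = -lassoc V (p * a) a x := by
  rw [lassoc_eq₂, map_sub, rmo_rmo_self ha, rmo_rmo, mul_mul_self_of_sq ha, rmo_neg, neg_apply]
  abel

lemma lmo_self_lassoc (p : Oct) (x : V) : lmo a (lassoc V a p x) = -lassoc V a (a * p) x := by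
  rw [lassoc_eq₀, map_sub, lmo_lmo_self ha, lmo_lmo, self_mul_mul_of_sq ha, lmo_neg, neg_apply]
  abel

lemma lassoc_rmo_self (p : Oct) (x : V) : lassoc V a p (rmo a x) = -lassoc V a (a * p) x := by
  rw [lassoc_eq₂, rmo_rmo_self ha, rmo_rmo, self_mul_mul_of_sq ha, rmo_neg, map_neg, neg_apply]
  abel

/-- The Moufang identity `p ((a x) a) = ((p a) x) a`. -/
lemma lmo_rmo_lmo (p : Oct) (x : V) : lmo p (rmo a (lmo a x)) = rmo a (lmo (p * a) x) := by
  have h₁ := lassoc_eq₁ a p (lmo a x)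
  rw [lmo_lmo p a, map_sub, lassoc_swap, lassoc_lmo_self ha, rmo_self_lassoc ha] at h₁
  rw [← sub_eq_zero] at h₁ ⊢
  rw [← h₁]
  abel

/-- The Moufang identity `((a x) a) p = a (x (a p))`. -/
lemma rmo_rmo_lmo (p : Oct) (x : V) : rmo p (rmo a (lmo a x)) = lmo a (rmo (a * p) x) := by
  have h₁ := lassoc_eq₁ p a (rmo a x)
  rw [rmo_rmo a p, map_add, lassoc_swap, lassoc_rmo_self ha, lmo_self_lassoc ha] at h₁
  rw [rmo_lmo a a, lassoc_self, add_zero]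
  rw [← sub_eq_zero] at h₁ ⊢
  rw [← neg_eq_zero, ← h₁]
  abel

/-- The Moufang identity `(a (p x)) a = (a p) (x a)`. -/
lemma rmo_lmo_lmo {p : Oct} (hp : ∀ x, lassoc V a (a * p) x = -lassoc V a (p * a) x) (x : V) :
    rmo a (lmo a (lmo p x)) = lmo (a * p) (rmo a x) := by
  rw [lmo_lmo a p, map_sub, rmo_lmo, lassoc_swap a p, map_neg, rmo_self_lassoc ha, hp,
    lassoc_swap (p * a)]
  abel

/-- The Moufang identity `(a (x p)) a = (a x) (p a)`. -/
lemma rmo_lmo_rmo {p : Oct} (hp : ∀ x, lassoc V a (a * p) x = -lassoc V a (p * a) x) (x : V) :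
    rmo a (lmo a (rmo p x)) = rmo (p * a) (lmo a x) := by
  rw [rmo_lmo a a, lassoc_self, add_zero, rmo_rmo p a, map_add, lassoc_swap p a, map_neg,
    lmo_self_lassoc ha, hp, rmo_lmo (p * a), lassoc_swap (p * a)]
  abel

end Moufang

namespace Oct

lemma conj_e_zero : conj (e 0) = 1 := by ext1 <;> simp [e_zero]

lemma conj_e_succ (j : Fin 7) : conj (e j.succ) = -e j.succ := by
  fin_cases j <;>
    ext <;>
    simp [e_a_re, e_a_imI, e_a_imJ, e_a_imK, e_b_re, e_b_imI, e_b_imJ, e_b_imK]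

lemma re_mul (x y : Oct) : re (x * y) = x.a.re * y.a.re - x.a.imI * y.a.imI - x.a.imJ * y.a.imJ
    - x.a.imK * y.a.imK - x.b.re * y.b.re - x.b.imI * y.b.imI - x.b.imJ * y.b.imJ
    - x.b.imK * y.b.imK := by
  simp only [re, mul_a, Quaternion.re_sub, Quaternion.re_mul, Quaternion.re_star,
    Quaternion.imI_star, Quaternion.imJ_star, Quaternion.imK_star]
  ring

lemma sum_re_mul_conj_e (p : Oct) : ∑ i : Fin 8, re (p * conj (e i)) • e i = p := by
  rw [Fin.sum_univ_eight]
  ext <;>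
    simp [re_mul, e_a_re, e_a_imI, e_a_imJ, e_a_imK, e_b_re, e_b_imI, e_b_imJ, e_b_imK]

lemma sum_re_e_mul (p : Oct) : ∑ i : Fin 8, re (e i * p) • conj (e i) = p := by
  rw [Fin.sum_univ_eight]
  ext <;>
    simp [re_mul, e_a_re, e_a_imI, e_a_imJ, e_a_imK, e_b_re, e_b_imI, e_b_imJ, e_b_imK]

lemma linearMap_ext {W : Type*} [AddCommGroup W] [Module ℝ W] {f g : Oct →ₗ[ℝ] W} (h₁ : f 1 = g 1)
    (h : ∀ j : Fin 7, f (e j.succ) = g (e j.succ)) : f = g := by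
  ext1 p
  rw [← sum_re_mul_conj_e p, map_sum, map_sum]
  refine Finset.sum_congr rfl fun i _ => ?_
  rw [map_smul, map_smul]
  congr 1
  exact Fin.cases h₁ h i

lemma re_smul_one (q : Oct) : (5 / 12 : ℝ) • q
    - (1 / 12 : ℝ) • ∑ i : Fin 7, e i.succ * q * e i.succ = re q • (1 : Oct) := by
  let f : Oct →ₗ[ℝ] Oct := (5 / 12 : ℝ) • LinearMap.id - (1 / 12 : ℝ) •
    ∑ i : Fin 7, (LinearMap.mulRight ℝ (e i.succ)).comp (LinearMap.mulLeft ℝ (e i.succ))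
  let g : Oct →ₗ[ℝ] Oct :=
    { toFun := fun q => re q • (1 : Oct)
      map_add' := fun x y => add_smul _ _ _
      map_smul' := fun r x => mul_smul _ _ _ }
  have hg : ∀ x, g x = re x • (1 : Oct) := fun _ => rfl
  have hfg : f = g := by
    refine linearMap_ext ?_ fun j => ?_
    · have h1 : re 1 = 1 := rfl
      simp [f, hg, Oct.mul_one', e_succ_sq, h1]
      rw [← Nat.cast_smul_eq_nsmul ℝ]
      module
    · have : ∀ i : Fin 7, e i.succ * e j.succ * e i.succ
          = if i = j then -e j.succ else e j.succ := fun i => by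
        split_ifs with hij
        · rw [hij, e_succ_sq, neg_mul, Oct.one_mul']
        · rw [e_mul_anticomm hij, neg_mul, mul_mul_self_of_sq (e_succ_sq i), neg_neg]
      have h0 : re (e j.succ) = 0 := by
        rw [re, e_a_re, if_neg (Fin.succ_ne_zero j)]
      simp [f, hg, this, h0, Finset.sum_ite, Finset.filter_eq', Finset.filter_ne']
      rw [← Nat.cast_smul_eq_nsmul ℝ]
      module
  have := LinearMap.congr_fun hfg q
  simpa [f, hg] using this

lemma sum_conj_e_mul (k : Fin 7) : ∑ i : Fin 8, conj (e i) * (e k.succ * e i)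
    = (-4 : ℝ) • e k.succ := by
  have : ∀ i : Fin 7, e i.succ * (e k.succ * e i.succ)
      = if i = k then -e k.succ else e k.succ := fun i => by
    split_ifs with hij
    · rw [hij, e_succ_sq, mul_neg, Oct.mul_one']
    · rw [e_mul_anticomm (Ne.symm hij), mul_neg, self_mul_mul_of_sq (e_succ_sq i), neg_neg]
  rw [Fin.sum_univ_succ, conj_e_zero, Oct.one_mul', e_zero, Oct.mul_one']
  simp [conj_e_succ, this, Finset.sum_ite, Finset.filter_eq', Finset.filter_ne']
  rw [← Nat.cast_smul_eq_nsmul ℝ]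
  module

end Oct

section RealPart

variable {V : Type*} [NormedAddCommGroup V] [NormedSpace ℝ V] [OctBimodule V]

lemma lassoc_e_mul (i j : Fin 7) (x : V) :
    lassoc V (e i.succ) (e i.succ * e j.succ) x = -lassoc V (e i.succ) (e j.succ * e i.succ) x := by
  rcases eq_or_ne i j with rfl | h
  · rw [e_succ_sq, map_neg, neg_apply, lassoc_one_right, neg_zero, neg_zero]
  · rw [e_mul_anticomm h, map_neg, neg_apply]

/-- The real-bilinear map `(p, q) ↦ p (x q)`. -/
def lmoRmo (x : V) : Oct →ₗ[ℝ] Oct →ₗ[ℝ] V :=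
  LinearMap.mk₂ ℝ (fun p q => lmo p (rmo q x))
    (fun p p' q => by rw [lmo_add, add_apply])
    (fun r p q => by rw [lmo_smul, smul_apply])
    (fun p q q' => by rw [rmo_add, add_apply, map_add])
    (fun r p q => by rw [rmo_smul, smul_apply, map_smul])

lemma lmoRmo_apply (x : V) (p q : Oct) : lmoRmo x p q = lmo p (rmo q x) := rfl

variable (V) in
/-- The operator `x ↦ ∑ e_i x e_i`, summed over the imaginary basis units. -/
def sandwich : V →L[ℝ] V := ∑ i : Fin 7, (rmo (e i.succ)).comp (lmo (e i.succ))

lemma sandwich_apply (x : V) :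
    sandwich V x = ∑ i : Fin 7, rmo (e i.succ) (lmo (e i.succ) x) := by
  simp [sandwich, sum_apply]

lemma reO_apply (x : V) : reO V x = (5 / 12 : ℝ) • x - (1 / 12 : ℝ) • sandwich V x := rfl

lemma lmo_sub_rmo_sandwich (j : Fin 7) (x : V) :
    lmo (e j.succ) (sandwich V x) - rmo (e j.succ) (sandwich V x)
      = (5 : ℝ) • (lmo (e j.succ) x - rmo (e j.succ) x) := by
  have h := sum_e_mul_comm (lmoRmo x) j
  have h' := sum_lassoc_e_mul j x
  simp only [Fin.sum_univ_succ (n := 7), lmoRmo_apply, e_zero, Oct.one_mul', Oct.mul_one', lmo_one,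
    rmo_one] at h
  simp only [sandwich_apply, map_sum, lmo_rmo_lmo (e_succ_sq _), rmo_rmo_lmo (e_succ_sq _)]
  simp only [rmo_lmo (e _) (e j.succ * e _), Finset.sum_add_distrib, h']
  linear_combination (norm := module) -h

lemma sandwich_lmo_sub_rmo (j : Fin 7) (x : V) :
    sandwich V (lmo (e j.succ) x) - sandwich V (rmo (e j.succ) x)
      = (5 : ℝ) • (lmo (e j.succ) x - rmo (e j.succ) x) := by
  have h := sum_e_mul_comm (lmoRmo x).flip j
  have h' := sum_lassoc_e_mul j x
  simp only [Fin.sum_univ_succ (n := 7), LinearMap.flip_apply, lmoRmo_apply, e_zero, Oct.one_mul',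
    Oct.mul_one', lmo_one, rmo_one] at h
  have h₁ : ∀ i : Fin 7, rmo (e i.succ) (lmo (e i.succ) (lmo (e j.succ) x))
      = lmo (e i.succ * e j.succ) (rmo (e i.succ) x) := fun i =>
    rmo_lmo_lmo (e_succ_sq i) (lassoc_e_mul i j) x
  have h₂ : ∀ i : Fin 7, rmo (e i.succ) (lmo (e i.succ) (rmo (e j.succ) x))
      = rmo (e j.succ * e i.succ) (lmo (e i.succ) x) := fun i =>
    rmo_lmo_rmo (e_succ_sq i) (lassoc_e_mul i j) x
  simp only [sandwich_apply, h₁, h₂]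
  simp only [rmo_lmo (e j.succ * e _) (e _), lassoc_swap (e j.succ * e _), Finset.sum_add_distrib,
    Finset.sum_neg_distrib, h']
  linear_combination (norm := module) h

lemma lmo_reO (p : Oct) (x : V) : lmo p (reO V x) = rmo p (reO V x) := by
  have h : (lmoRmo (reO V x)).flip 1 = lmoRmo (reO V x) 1 := by
    refine linearMap_ext rfl fun j => ?_
    have := lmo_sub_rmo_sandwich j x
    simp only [LinearMap.flip_apply, lmoRmo_apply, lmo_one, rmo_one, reO_apply, map_sub, map_smul]
    linear_combination (norm := module) (-1 / 12 : ℝ) • this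
  simpa [lmoRmo_apply, lmo_one, rmo_one] using LinearMap.congr_fun h p

lemma reO_lmo (p : Oct) (x : V) : reO V (lmo p x) = reO V (rmo p x) := by
  have h : (reO V).toLinearMap ∘ₗ (lmoRmo x).flip 1 = (reO V).toLinearMap ∘ₗ lmoRmo x 1 := by
    refine linearMap_ext rfl fun j => ?_
    have := sandwich_lmo_sub_rmo j x
    simp only [LinearMap.comp_apply, ContinuousLinearMap.coe_coe, LinearMap.flip_apply,
      lmoRmo_apply, lmo_one, rmo_one, reO_apply]
    linear_combination (norm := module) (-1 / 12 : ℝ) • this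
  simpa [lmoRmo_apply, lmo_one, rmo_one] using LinearMap.congr_fun h p

lemma mem_ReSet_of_comm {x : V} (h : ∀ p : Oct, lmo p x = rmo p x) : x ∈ ReSet V := by
  refine ⟨fun p q => ?_, h⟩
  have h₀ := lassoc_eq₀ p q x
  have h₁ := lassoc_eq₁ q p x
  have h₂ := lassoc_eq₂ p q x
  rw [← h q, lassoc_swap] at h₁
  rw [← h p, ← h (p * q)] at h₂
  have key : (3 : ℝ) • lassoc V p q x = 0 := by
    linear_combination (norm := module) h₀ - h₁ + h₂
  have := (smul_eq_zero.mp key).resolve_left three_ne_zero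
  rw [← sub_eq_zero, ← h₀, this]

lemma reO_mem_ReSet (x : V) : reO V x ∈ ReSet V := mem_ReSet_of_comm fun p => lmo_reO p x

lemma reO_lassoc (p q : Oct) (x : V) : reO V (lassoc V p q x) = 0 := by
  have h₀ := congrArg (reO V) (lassoc_eq₀ p q x)
  have h₁ := congrArg (reO V) (lassoc_eq₁ p q x)
  have h₂ := congrArg (reO V) (lassoc_eq₂ p q x)
  rw [map_sub] at h₀ h₁ h₂
  rw [reO_lmo, reO_lmo] at h₀
  rw [reO_lmo] at h₁
  have key : (3 : ℝ) • reO V (lassoc V p q x) = 0 := by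
    linear_combination (norm := module) h₀ + h₁ + h₂
  exact (smul_eq_zero.mp key).resolve_left three_ne_zero

lemma reO_rmo_mul (p q : Oct) (x : V) : reO V (rmo (p * q) x) = reO V (rmo q (rmo p x)) := by
  rw [rmo_rmo, map_add, reO_lassoc, add_zero]

end RealPart

section Expansion

variable {V : Type*} [NormedAddCommGroup V] [NormedSpace ℝ V] [OctBimodule V]

lemma rmo_rmo_conj_e (i : Fin 8) (x : V) : rmo (e i) (rmo (conj (e i)) x) = x := by
  refine Fin.cases ?_ (fun j => ?_) i
  · rw [conj_e_zero, e_zero, rmo_one, rmo_one]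
  · rw [conj_e_succ, rmo_neg, neg_apply, map_neg, rmo_rmo_self (e_succ_sq j), neg_neg]

lemma sum_lassoc_conj_e (k : Fin 7) (x : V) :
    ∑ i : Fin 8, lassoc V (conj (e i)) (e k.succ * e i) x
      = (-4 : ℝ) • (lmo (e k.succ) x - rmo (e k.succ) x) := by
  rw [Fin.sum_univ_succ, conj_e_zero, lassoc_one_left, zero_add]
  simp only [conj_e_succ, map_neg, LinearMap.neg_apply, neg_apply, Finset.sum_neg_distrib,
    sum_lassoc_e_mul, neg_smul]

lemma sum_rmo_sandwich (x : V) :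
    ∑ i : Fin 8, rmo (e i) (sandwich V (rmo (conj (e i)) x)) = (28 : ℝ) • x := by
  have h : ∀ k : Fin 7, ∑ i : Fin 8, rmo (e k.succ * e i) (rmo (conj (e i)) x)
      = (-4 : ℝ) • lmo (e k.succ) x := fun k => by
    have h₁ : rmo (∑ i : Fin 8, conj (e i) * (e k.succ * e i)) x
        = ∑ i : Fin 8, rmo (conj (e i) * (e k.succ * e i)) x := by
      simp [rmo, sum_apply]
    rw [sum_conj_e_mul, rmo_smul, smul_apply] at h₁
    simp only [rmo_rmo, Finset.sum_add_distrib, sum_lassoc_conj_e, ← h₁]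
    module
  simp only [sandwich_apply, map_sum, rmo_rmo_lmo (e_succ_sq _)]
  rw [Finset.sum_comm]
  simp only [← map_sum, h, map_smul, lmo_lmo_self (e_succ_sq _)]
  simp only [Finset.sum_const, Finset.card_univ, Fintype.card_fin, ← Nat.cast_smul_eq_nsmul ℝ]
  module

/-- The expansion `x = ∑ Re (x ē_i) e_i`. -/
lemma sum_rmo_reO_conj (x : V) : ∑ i : Fin 8, rmo (e i) (reO V (rmo (conj (e i)) x)) = x := by
  simp only [reO_apply, map_sub, map_smul, rmo_rmo_conj_e, Finset.sum_sub_distrib, ← Finset.smul_sum,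
    sum_rmo_sandwich]
  simp only [Finset.sum_const, Finset.card_univ, Fintype.card_fin, ← Nat.cast_smul_eq_nsmul ℝ]
  module

section ReSet

variable {u : V} (hu : u ∈ ReSet V)
include hu

lemma lassoc_of_mem_ReSet (p q : Oct) : lassoc V p q u = 0 := by
  rw [lassoc_eq₀, hu.1, sub_self]

lemma rmo_rmo_of_mem_ReSet (p q : Oct) : rmo q (rmo p u) = rmo (p * q) u := by
  rw [rmo_rmo, lassoc_of_mem_ReSet hu, add_zero]

lemma lmo_rmo_of_mem_ReSet (p q : Oct) : lmo p (rmo q u) = rmo (p * q) u := by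
  rw [← hu.2 q, ← hu.1, hu.2]

lemma reO_rmo_of_mem_ReSet (q : Oct) : reO V (rmo q u) = re q • u := by
  have h₁ : rmo (re q • (1 : Oct)) u = re q • u := by rw [rmo_smul, smul_apply, rmo_one]
  rw [← h₁, ← re_smul_one, reO_apply, sandwich_apply, rmo_sub, rmo_smul, rmo_smul, sub_apply,
    smul_apply, smul_apply]
  congr 2
  simp only [lmo_rmo_of_mem_ReSet hu, rmo_rmo_of_mem_ReSet hu]
  simp [rmo, sum_apply]

end ReSet

lemma lifO_apply (F : V →L[ℝ] V) (x : V) :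
    lifO F x = ∑ i : Fin 8, rmo (e i) (F (rmo (conj (e i)) x)) := by
  simp [lifO, sum_apply]

lemma extO_apply (F : V →L[ℝ] V) (x : V) :
    extO F x = ∑ i : Fin 8, rmo (e i) (F (reO V (rmo (conj (e i)) x))) := by
  simp [extO, sum_apply]

lemma rmo_sum_re_mul_conj_e (p : Oct) (u : V) :
    ∑ i : Fin 8, re (p * conj (e i)) • rmo (e i) u = rmo p u := by
  conv_rhs => rw [← sum_re_mul_conj_e p]
  simp [rmo, sum_apply]

/-- The extension map is right linear on the real part. -/
lemma extO_rmo (G : V →L[ℝ] V) {u : V} (hu : u ∈ ReSet V) (p : Oct) :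
    extO G (rmo p u) = rmo p (G u) := by
  rw [extO_apply, ← rmo_sum_re_mul_conj_e p (G u)]
  refine Finset.sum_congr rfl fun i _ => ?_
  rw [rmo_rmo_of_mem_ReSet hu, reO_rmo_of_mem_ReSet hu, map_smul, map_smul]

lemma reO_rmo_comm {T : V →L[ℝ] V} (hT : IsRightPara T) (p : Oct) (x : V) :
    reO V (T (rmo p x)) = reO V (rmo p (T x)) := by
  have := hT p x
  rw [Bop, sub_apply, map_sub, sub_eq_zero] at this
  exact this.symm

lemma reO_rmo_lifO {F : V →L[ℝ] V} (hF : ∀ x, F x ∈ ReSet V) (p : Oct) (x : V) :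
    reO V (rmo p (lifO F x)) = F (rmo p x) := by
  conv_rhs => rw [← sum_re_e_mul p]
  simp only [lifO_apply, map_sum, rmo_rmo_of_mem_ReSet (hF _), reO_rmo_of_mem_ReSet (hF _)]
  simp [rmo, sum_apply]

/-- Liftings have the prescribed real part. -/
lemma reO_lifO {F : V →L[ℝ] V} (hF : ∀ x, F x ∈ ReSet V) (x : V) : reO V (lifO F x) = F x := by
  simpa [rmo_one] using reO_rmo_lifO hF 1 x

lemma isRightPara_lifO {F : V →L[ℝ] V} (hF : ∀ x, F x ∈ ReSet V) : IsRightPara (lifO F) := by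
  intro p x
  rw [Bop, sub_apply, map_sub, ContinuousLinearMap.comp_apply, ContinuousLinearMap.comp_apply,
    reO_rmo_lifO hF, reO_lifO hF, sub_self]

end Expansion

namespace Oct

lemma re_a_eq_zero_of_sq {J : Oct} (hJ : J * J = -1) : J.a.re = 0 := by
  have h₁ := congrArg (fun x : Oct => x.a.re) hJ
  have h₂ := congrArg (fun x : Oct => x.a.imI) hJ
  have h₃ := congrArg (fun x : Oct => x.a.imJ) hJ
  have h₄ := congrArg (fun x : Oct => x.a.imK) hJ
  have h₅ := congrArg (fun x : Oct => x.b.re) hJ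
  have h₆ := congrArg (fun x : Oct => x.b.imI) hJ
  have h₇ := congrArg (fun x : Oct => x.b.imJ) hJ
  have h₈ := congrArg (fun x : Oct => x.b.imK) hJ
  simp only [mul_a, mul_b, neg_a, neg_b, one_a, one_b, Quaternion.re_sub, Quaternion.imI_sub,
    Quaternion.imJ_sub, Quaternion.imK_sub, Quaternion.re_add, Quaternion.imI_add,
    Quaternion.imJ_add, Quaternion.imK_add, Quaternion.re_mul, Quaternion.imI_mul,
    Quaternion.imJ_mul, Quaternion.imK_mul, Quaternion.re_star, Quaternion.imI_star,
    Quaternion.imJ_star, Quaternion.imK_star, Quaternion.re_neg, Quaternion.imI_neg,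
    Quaternion.imJ_neg, Quaternion.imK_neg, Quaternion.re_one, Quaternion.imI_one,
    Quaternion.imJ_one, Quaternion.imK_one, Quaternion.re_zero, Quaternion.imI_zero,
    Quaternion.imJ_zero, Quaternion.imK_zero] at h₁ h₂ h₃ h₄ h₅ h₆ h₇ h₈
  by_contra h
  have key : ∀ t : ℝ, J.a.re * t = 0 → t = 0 := fun t ht => (mul_eq_zero.mp ht).resolve_left h
  have g₂ := key J.a.imI (by linarith)
  have g₃ := key J.a.imJ (by linarith)
  have g₄ := key J.a.imK (by linarith)
  have g₅ := key J.b.re (by linarith)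
  have g₆ := key J.b.imI (by linarith)
  have g₇ := key J.b.imJ (by linarith)
  have g₈ := key J.b.imK (by linarith)
  simp only [g₂, g₃, g₄, g₅, g₆, g₇, g₈] at h₁
  nlinarith [sq_nonneg J.a.re]

lemma conj_of_sq {J : Oct} (hJ : J * J = -1) : conj J = -J := by
  have h := re_a_eq_zero_of_sq hJ
  ext <;> simp [h]

lemma normSq_of_sq {J : Oct} (hJ : J * J = -1) :
    Quaternion.normSq J.a + Quaternion.normSq J.b = 1 := by
  have h₁ := congrArg (fun x : Oct => x.a.re) hJ
  have h := re_a_eq_zero_of_sq hJ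
  simp [h, Quaternion.re_one] at h₁
  rw [Quaternion.normSq_def', Quaternion.normSq_def', h]
  linarith

section Slice

variable {J : Oct} (hJ : J * J = -1)

lemma toSlice_one : toSlice J 1 = 1 := by simp [toSlice]

lemma toSlice_I : toSlice J Complex.I = J := by simp [toSlice]

include hJ

lemma norm_toSlice (z : ℂ) : ‖toSlice J z‖ = ‖z‖ := by
  have h := normSq_of_sq hJ
  have h₀ := re_a_eq_zero_of_sq hJ
  rw [Quaternion.normSq_def', Quaternion.normSq_def', h₀] at h
  rw [← sq_eq_sq₀ (norm_nonneg _) (norm_nonneg _), norm_sq, Complex.sq_norm, Complex.normSq_apply,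
    Quaternion.normSq_def', Quaternion.normSq_def']
  simp [toSlice, h₀, Quaternion.re_one, Quaternion.imI_one, Quaternion.imJ_one, Quaternion.imK_one]
  linear_combination z.im ^ 2 * h

lemma toSlice_mul (z w : ℂ) : toSlice J z * toSlice J w = toSlice J (z * w) := by
  simp only [toSlice, add_mul, mul_add, smul_mul_assoc, mul_smul_comm, Oct.one_mul', Oct.mul_one',
    hJ, Complex.mul_re, Complex.mul_im]
  module

lemma opow_toSlice (z : ℂ) (n : ℕ) : opow (toSlice J z) n = toSlice J (z ^ n) := by
  induction n with
  | zero => rw [pow_zero, toSlice_one]; rfl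
  | succ n ih => rw [opow, ih, toSlice_mul hJ, pow_succ']

lemma oinv_toSlice (z : ℂ) : oinv (toSlice J z) = toSlice J z⁻¹ := by
  have h : conj (toSlice J z) = z.re • (1 : Oct) - z.im • J := by
    rw [sub_eq_add_neg, ← smul_neg, ← conj_of_sq hJ]
    ext <;> simp [toSlice]
  rw [oinv, norm_toSlice hJ, h, toSlice, Complex.sq_norm, Complex.inv_re, Complex.inv_im,
    div_eq_inv_mul, div_eq_inv_mul]
  module

lemma invPow_toSlice (z : ℂ) (n : ℕ) : invPow (toSlice J z) n = toSlice J (z⁻¹ ^ (n + 1)) := by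
  rw [invPow, oinv_toSlice hJ, opow_toSlice hJ]

end Slice

end Oct

section SliceModule

variable {V : Type*} [NormedAddCommGroup V] [NormedSpace ℝ V] [OctBimodule V]

lemma lassoc_toSlice (J : Oct) (z w : ℂ) (x : V) :
    lassoc V (toSlice J z) (toSlice J w) x = 0 := by
  simp only [toSlice, map_add, map_smul, LinearMap.add_apply, LinearMap.smul_apply, add_apply,
    smul_apply, lassoc_one_left, lassoc_one_right, lassoc_self, smul_zero, add_zero]

variable {J : Oct} (hJ : J * J = -1)
include hJ

lemma rmo_rmo_toSlice (z w : ℂ) (x : V) :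
    rmo (toSlice J z) (rmo (toSlice J w) x) = rmo (toSlice J (z * w)) x := by
  rw [rmo_rmo, lassoc_toSlice, add_zero, toSlice_mul hJ, mul_comm]

lemma lmo_lmo_toSlice (z w : ℂ) (x : V) :
    lmo (toSlice J z) (lmo (toSlice J w) x) = lmo (toSlice J (z * w)) x := by
  rw [lmo_lmo, lassoc_toSlice, sub_zero, toSlice_mul hJ]

lemma piJ_congr {x y : V}
    (h : ∀ z : ℂ, reO V (rmo (toSlice J z) x) = reO V (rmo (toSlice J z) y)) :
    piJ V J x = piJ V J y := by
  have h₁ := h 1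
  have h₂ := h (-Complex.I)
  have h₃ : toSlice J (-Complex.I) = conj J := by simp [toSlice, conj_of_sq hJ]
  rw [toSlice_one, rmo_one, rmo_one] at h₁
  rw [h₃, ← reO_lmo, ← reO_lmo] at h₂
  simp only [piJ, add_apply, ContinuousLinearMap.comp_apply, h₁, h₂]

lemma piJ_lmo (z : ℂ) (x : V) : piJ V J (lmo (toSlice J z) x) = piJ V J (rmo (toSlice J z) x) :=
  piJ_congr hJ fun w => by
    rw [← reO_lmo, lmo_lmo_toSlice hJ, reO_lmo, rmo_rmo_toSlice hJ]

lemma piJ_rmo_comm {F : V →L[ℝ] V} (hF : IsRightPara F) (z w : ℂ) (x : V) :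
    piJ V J (rmo (toSlice J w) (F (rmo (toSlice J z) x)))
      = piJ V J (rmo (toSlice J (w * z)) (F x)) :=
  piJ_congr hJ fun v => by
    rw [rmo_rmo_toSlice hJ, ← reO_rmo_comm hF, rmo_rmo_toSlice hJ, rmo_rmo_toSlice hJ,
      reO_rmo_comm hF, mul_assoc]

lemma piJ_odotL {F : V →L[ℝ] V} (hF : IsRightPara F) (z : ℂ) (x : V) :
    piJ V J (odotL (toSlice J z) F x) = piJ V J (rmo (toSlice J z) (F x)) := by
  have h := piJ_rmo_comm hJ hF z 1 x
  rw [toSlice_one, rmo_one, one_mul] at h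
  rw [odotL, Bop, add_apply, sub_apply, map_add, map_sub, ContinuousLinearMap.comp_apply,
    ContinuousLinearMap.comp_apply, ContinuousLinearMap.comp_apply, piJ_lmo hJ, h, sub_self,
    add_zero]

end SliceModule

section Resolvent

variable {V : Type*} [NormedAddCommGroup V] [NormedSpace ℝ V] [OctBimodule V]

lemma norm_pow_apply_le (T : V →L[ℝ] V) (n : ℕ) (x : V) : ‖(T ^ n) x‖ ≤ ‖T‖ ^ n * ‖x‖ := by
  induction n with
  | zero => simp
  | succ n ih =>
    rw [pow_succ', pow_succ', mul_apply_eq_comp, mul_assoc]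
    exact (T.le_opNorm _).trans (by gcongr)

lemma norm_rmo (p : Oct) (x : V) : ‖rmo p x‖ = ‖p‖ * ‖x‖ := OctBimodule.norm_rm p x

lemma norm_lmo (p : Oct) (x : V) : ‖lmo p x‖ = ‖p‖ * ‖x‖ := OctBimodule.norm_lm p x

lemma norm_rpowL_apply_le (T : V →L[ℝ] V) : ∃ C : ℝ, ∀ (n : ℕ) (x : V),
    ‖rpowL T n x‖ ≤ C * ‖T‖ ^ n * ‖x‖ := by
  refine ⟨∑ i : Fin 8, ‖e i‖ * ‖reO V‖ * ‖conj (e i)‖, fun n x => ?_⟩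
  rw [rpowL, lifO_apply, Finset.sum_mul, Finset.sum_mul]
  refine norm_sum_le_of_le _ fun i _ => ?_
  rw [norm_rmo, ContinuousLinearMap.comp_apply]
  calc ‖e i‖ * ‖reO V ((T ^ n) (rmo (conj (e i)) x))‖
      ≤ ‖e i‖ * (‖reO V‖ * (‖T‖ ^ n * ‖rmo (conj (e i)) x‖)) := by
        gcongr
        exact ((reO V).le_opNorm _).trans (by gcongr; exact norm_pow_apply_le T n _)
    _ = ‖e i‖ * ‖reO V‖ * ‖conj (e i)‖ * ‖T‖ ^ n * ‖x‖ := by rw [norm_rmo]; ring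

lemma rpowL_isRightPara (T : V →L[ℝ] V) (n : ℕ) : IsRightPara (rpowL T n) :=
  isRightPara_lifO fun _ => reO_mem_ReSet _

lemma rpowL_zero (T : V →L[ℝ] V) (x : V) : rpowL T 0 x = x := by
  rw [rpowL, lifO_apply]
  exact sum_rmo_reO_conj x

lemma rcomp_rpowL (T : V →L[ℝ] V) (n : ℕ) : rcomp (rpowL T n) T = rpowL T (n + 1) := by
  rw [rcomp, rpowL, rpowL, pow_succ]
  congr 1
  ext x
  exact reO_lifO (F := (reO V).comp (T ^ n)) (fun x => reO_mem_ReSet _) (T x)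

lemma rpowR_rmo (T : V →L[ℝ] V) (n : ℕ) {u : V} (hu : u ∈ ReSet V) (p : Oct) :
    rpowR T n (rmo p u) = rmo p ((T ^ n) u) := extO_rmo _ hu p

lemma rcomp_rpowR_rmo {T : V →L[ℝ] V} (hT : IsRightPara T) (n : ℕ) {u : V} (hu : u ∈ ReSet V)
    (p : Oct) : rcomp T (rpowR T n) (rmo p u) = rmo p ((T ^ (n + 1)) u) := by
  simp only [rcomp, lifO_apply, ContinuousLinearMap.comp_apply, rmo_rmo_of_mem_ReSet hu,
    rpowR_rmo T n hu, reO_rmo_comm hT, reO_rmo_mul, sum_rmo_reO_conj]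
  rw [pow_succ', mul_apply_eq_comp]

variable {J : Oct} (hJ : J * J = -1)

include hJ in
lemma odotR_rpowR_rmo (T : V →L[ℝ] V) (n : ℕ) {u : V} (hu : u ∈ ReSet V) (z w : ℂ) :
    odotR (rpowR T n) (toSlice J z) (rmo (toSlice J w) u)
      = rmo (toSlice J (z * w)) ((T ^ n) u) := by
  rw [odotR, Bop, sub_apply, sub_apply, ContinuousLinearMap.comp_apply,
    ContinuousLinearMap.comp_apply, ContinuousLinearMap.comp_apply, lmo_rmo_of_mem_ReSet hu,
    toSlice_mul hJ, rmo_rmo_toSlice hJ, rpowR_rmo T n hu, rpowR_rmo T n hu, rmo_rmo_toSlice hJ,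
    sub_self, sub_zero]

variable [CompleteSpace V] {T : V →L[ℝ] V} {σ : ℂ} (hσ : ‖T‖ < ‖σ‖)
include hσ

lemma summable_of_le_geometric {f : ℕ → V} {C : ℝ}
    (hf : ∀ n, ‖f n‖ ≤ C * (‖σ⁻¹ ^ n‖ * ‖T‖ ^ n)) : Summable f := by
  have hσ₀ : 0 < ‖σ‖ := (norm_nonneg T).trans_lt hσ
  have hr : ‖σ‖⁻¹ * ‖T‖ < 1 := by rwa [inv_mul_lt_one₀ hσ₀]
  refine Summable.of_norm_bounded
    ((summable_geometric_of_lt_one (by positivity) hr).mul_left C) fun n => ?_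
  rw [mul_pow, ← norm_inv, ← norm_pow]
  exact hf n

include hJ

lemma summable_rmo_toSlice {f : ℕ → V} {C : ℝ} (hf : ∀ n, ‖f n‖ ≤ C * ‖T‖ ^ n) (c : ℂ) :
    Summable fun n => rmo (toSlice J (σ⁻¹ ^ n * c)) (f n) :=
  summable_of_le_geometric hσ (C := ‖c‖ * C) fun n => by
    rw [norm_rmo, norm_toSlice hJ, norm_mul]
    calc (‖σ⁻¹ ^ n‖ * ‖c‖) * ‖f n‖ ≤ (‖σ⁻¹ ^ n‖ * ‖c‖) * (C * ‖T‖ ^ n) := by gcongr; exact hf n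
      _ = _ := by ring

lemma summable_odotL_toSlice {F : ℕ → V →L[ℝ] V} {C : ℝ}
    (hF : ∀ n x, ‖F n x‖ ≤ C * ‖T‖ ^ n * ‖x‖) (c : ℂ) (x : V) :
    Summable fun n => odotL (toSlice J (σ⁻¹ ^ n * c)) (F n) x :=
  summable_of_le_geometric hσ (C := 3 * ‖c‖ * C * ‖x‖) fun n => by
    have h := hF n (rmo (toSlice J (σ⁻¹ ^ n * c)) x)
    rw [norm_rmo, norm_toSlice hJ, norm_mul] at h
    have h' : (‖σ⁻¹ ^ n‖ * ‖c‖) * ‖F n x‖ ≤ (‖σ⁻¹ ^ n‖ * ‖c‖) * (C * ‖T‖ ^ n * ‖x‖) := by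
      gcongr
      exact hF n x
    rw [odotL, Bop, add_apply, sub_apply]
    refine (norm_add_le _ _).trans ?_
    grw [norm_sub_le]
    simp only [ContinuousLinearMap.comp_apply]
    rw [norm_lmo, norm_rmo, norm_toSlice hJ, norm_mul]
    linarith

lemma resolvent_right_slice (hT : IsRightPara T) {u : V} (hu : u ∈ ReSet V) (c : ℂ) :
    ∃ A B : V,
      HasSum (fun n => odotR (rpowR T n) (invPow (toSlice J σ) n) (rmo (toSlice J c) u)) A ∧
      HasSum (fun n => compAssoc T (rpowR T n)
        (rmo (invPow (toSlice J σ) n) (rmo (toSlice J c) u))) B ∧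
      (rmo (toSlice J σ) - T : V →L[ℝ] V) A = rmo (toSlice J c) u + B := by
  have hσ₀ : σ ≠ 0 := norm_pos_iff.mp ((norm_nonneg T).trans_lt hσ)
  have hs := fun d : ℂ => summable_rmo_toSlice hJ hσ (f := fun n => (T ^ n) u) (C := ‖u‖)
    (fun n => (norm_pow_apply_le T n u).trans_eq (mul_comm _ _)) d
  have hA := (hs (σ⁻¹ * c)).hasSum
  have hH := (hs c).hasSum
  have hH' := (hasSum_nat_add_iff' 1).mpr hH
  refine ⟨_, _, hA.congr_fun fun n => ?_, (hH'.sub (T.hasSum hA)).congr_fun fun n => ?_, ?_⟩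
  · rw [invPow_toSlice hJ, odotR_rpowR_rmo hJ T n hu, pow_succ, mul_assoc]
  · rw [invPow_toSlice hJ, rmo_rmo_toSlice hJ, compAssoc, rcomp_rpowR_rmo hT n hu,
      rpowR_rmo T n hu]
    simp only [pow_succ, mul_assoc]
  · have h : HasSum (fun n => rmo (toSlice J (σ⁻¹ ^ n * c)) ((T ^ n) u)) (rmo (toSlice J σ)
        (∑' n, rmo (toSlice J (σ⁻¹ ^ n * (σ⁻¹ * c))) ((T ^ n) u))) := by
      refine ((rmo (toSlice J σ)).hasSum hA).congr_fun fun n => ?_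
      rw [rmo_rmo_toSlice hJ]
      congr 3
      field_simp
    rw [sub_apply, h.unique hH]
    simp
    abel

lemma resolvent_left_slice (x : V) :
    Summable (fun n => odotL (invPow (toSlice J σ) n) (rpowL T n)
      ((rmo (toSlice J σ) - T : V →L[ℝ] V) x)) ∧
    Summable (fun n => rmo (invPow (toSlice J σ) n) (compAssoc (rpowL T n) T x)) ∧
    piJ V J (∑' n, odotL (invPow (toSlice J σ) n) (rpowL T n)
      ((rmo (toSlice J σ) - T : V →L[ℝ] V) x)) = piJ V J x +
        piJ V J (∑' n, rmo (invPow (toSlice J σ) n) (compAssoc (rpowL T n) T x)) := by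
  have hσ₀ : σ ≠ 0 := norm_pos_iff.mp ((norm_nonneg T).trans_lt hσ)
  obtain ⟨C, hC⟩ := norm_rpowL_apply_le T
  have hs := fun (y : V) (d : ℂ) => summable_rmo_toSlice hJ hσ (f := fun n => rpowL T n y)
    (C := C * ‖y‖) (fun n => (hC n y).trans_eq (by ring)) d
  have hK := hs x 1
  have hK' := (hasSum_nat_add_iff' 1).mpr hK.hasSum
  have hD := hs (T x) σ⁻¹
  have hc : ∀ n, rmo (toSlice J (σ⁻¹ ^ (n + 1) * 1)) (rpowL T (n + 1) x)
      - rmo (toSlice J (σ⁻¹ ^ n * σ⁻¹)) (rpowL T n (T x))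
      = rmo (invPow (toSlice J σ) n) (compAssoc (rpowL T n) T x) := fun n => by
    rw [invPow_toSlice hJ, compAssoc, rcomp_rpowL, map_sub, mul_one, pow_succ]
  have hcs : HasSum (fun n => rmo (invPow (toSlice J σ) n) (compAssoc (rpowL T n) T x)) _ :=
    (hK'.sub hD.hasSum).congr_fun fun n => (hc n).symm
  have hodot : Summable (fun n => odotL (invPow (toSlice J σ) n) (rpowL T n)
      ((rmo (toSlice J σ) - T : V →L[ℝ] V) x)) := by
    refine (summable_odotL_toSlice hJ hσ hC σ⁻¹
      ((rmo (toSlice J σ) - T : V →L[ℝ] V) x)).congr fun n => ?_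
    rw [invPow_toSlice hJ, pow_succ]
  refine ⟨hodot, hcs.summable, ?_⟩
  rw [hcs.tsum_eq]
  have h₁ : HasSum (fun n => piJ V J (odotL (invPow (toSlice J σ) n) (rpowL T n)
      ((rmo (toSlice J σ) - T : V →L[ℝ] V) x))) _ :=
    (((piJ V J).hasSum hK.hasSum).sub ((piJ V J).hasSum hD.hasSum)).congr_fun fun n => by
      rw [invPow_toSlice hJ, piJ_odotL hJ (rpowL_isRightPara T n), sub_apply, map_sub, map_sub,
        map_sub, piJ_rmo_comm hJ (rpowL_isRightPara T n), pow_succ, mul_assoc,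
        inv_mul_cancel₀ hσ₀]
  rw [((piJ V J).hasSum hodot.hasSum).unique h₁, map_sub, map_sub]
  simp [toSlice_one, rmo_one, rpowL_zero]
  abel

end Resolvent

/-- resolvent operator series identities.  Let `V` be a Banach
`𝕆`-bimodule, `T` a bounded right para-linear operator on `V`, `J ∈ 𝕊` and `s ∈ ℂ_J` with
`|s| > ‖T‖`.  Then (1) for all `x ∈ ℂ_J(V)`,
`(R_s − T)(∑_{n≥0} (T^{⊚n} ⊙ s^{−1−n})(x)) = x + α(s,T)(x)` with
`α(s,T)(x) = ∑_{n≥0} [T, T^{⊚n}, x s^{−1−n}]_⊚`, and (2) for all `x ∈ V`,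
`π_J(∑_{n≥0} (s^{−1−n} ⊙ T^{n⊚})((R_s − T)(x))) = π_J(x) + β(s,T)(x)` with
`β(s,T)(x) = π_J(∑_{n≥0} [T^{n⊚}, T, x]_⊚ · s^{−1−n})`; all series converge in norm. -/
theorem statement_0 {V : Type*} [NormedAddCommGroup V] [NormedSpace ℝ V] [CompleteSpace V]
    [OctBimodule V] (T : V →L[ℝ] V) (hT : IsRightPara T)
    (J : Oct) (hJ : J ∈ unitSphere) (s : Oct) (hs : s ∈ sliceC J) (hnorm : ‖T‖ < ‖s‖) :
    (∀ x ∈ CJV V J,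
      Summable (fun n : ℕ => (odotR (rpowR T n) (Oct.invPow s n)) x) ∧
      Summable (fun n : ℕ => compAssoc T (rpowR T n) (rmo (Oct.invPow s n) x)) ∧
      ((rmo s - T : V →L[ℝ] V)) (∑' n : ℕ, (odotR (rpowR T n) (Oct.invPow s n)) x) =
        x + ∑' n : ℕ, compAssoc T (rpowR T n) (rmo (Oct.invPow s n) x)) ∧
    (∀ x : V,
      Summable (fun n : ℕ => (odotL (Oct.invPow s n) (rpowL T n)) (((rmo s - T : V →L[ℝ] V)) x)) ∧
      Summable (fun n : ℕ => rmo (Oct.invPow s n) (compAssoc (rpowL T n) T x)) ∧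
      piJ V J (∑' n : ℕ, (odotL (Oct.invPow s n) (rpowL T n)) (((rmo s - T : V →L[ℝ] V)) x)) =
        piJ V J x +
          piJ V J (∑' n : ℕ, rmo (Oct.invPow s n) (compAssoc (rpowL T n) T x))) := by
  obtain ⟨a, b, rfl⟩ := hs
  have hJ' : J * J = -1 := hJ
  obtain ⟨σ, hσ⟩ : ∃ σ : ℂ, a • (1 : Oct) + b • J = toSlice J σ := ⟨⟨a, b⟩, rfl⟩
  rw [hσ] at hnorm ⊢
  rw [norm_toSlice hJ'] at hnorm
  refine ⟨?_, resolvent_left_slice hJ' hnorm⟩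
  rintro _ ⟨u, hu, w, hw, rfl⟩
  obtain ⟨A, B, hA, hB, hAB⟩ := resolvent_right_slice hJ' hnorm hT hu 1
  obtain ⟨A', B', hA', hB', hAB'⟩ := resolvent_right_slice hJ' hnorm hT hw Complex.I
  rw [toSlice_one, rmo_one] at hAB
  rw [toSlice_I, ← hw.2] at hAB'
  simp only [toSlice_one, rmo_one] at hA hB
  simp only [toSlice_I, ← hw.2] at hA' hB'
  have h₁ := (hA.add hA').congr_fun fun n =>
    map_add (odotR (rpowR T n) (invPow (toSlice J σ) n)) u (lmo J w)
  have h₂ : HasSum (fun n => compAssoc T (rpowR T n)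
      (rmo (invPow (toSlice J σ) n) (u + lmo J w))) (B + B') :=
    (hB.add hB').congr_fun fun n => by
      simp only [compAssoc, map_add]
      abel
  refine ⟨h₁.summable, h₂.summable, ?_⟩
  rw [h₁.tsum_eq, h₂.tsum_eq, map_add, hAB, hAB']
  abel
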